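/- arXiv:2303.03351 — 3 statements merged into one kernel-verified Lean document; each statement's English description precedes it below -/
import Mathlib

section
/- Let U be a nonempty set, f : ℝ^{n_x} × U → ℝ^{n_x}, and c : ℝ^{n_x} × U → ℝ with c(x,u) ≥ δ for some δ > 0 and all x, u, and assume c is bounded above. Then the Kružkov–Bellman operator S[v](x) = sup_{u∈U} { exp(−c(x,u)) · v(f(x,u)) } has a unique bounded fixed point v̂ : ℝ^{n_x} → ℝ, and for every bounded initial guess v⁰ the iterates v^{m+1} = S[v^m] converge uniformly to v̂, with sup_x |v^m(x) − v̂(x)| ≤ exp(−mδ) · sup_x |v⁰(x) − v̂(x)| for all m ∈ ℕ. -/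
/-- The Kružkov–Bellman operator `S[v](x) = sup_{u∈U} { exp(−c(x,u))·v(f(x,u)) }`. -/
noncomputable def kruzkovBellman {X U : Type*} (f : X → U → X) (c : X → U → ℝ)
    (v : X → ℝ) (x : X) : ℝ :=
  sSup {r : ℝ | ∃ u : U, r = Real.exp (-c x u) * v (f x u)}

section KruzkovBellman

variable {X U : Type*} [Nonempty U] {f : X → U → X} {c : X → U → ℝ} {δ : ℝ}

theorem kruzkovBellman_le_add (hc : ∀ x u, δ ≤ c x u) {v w : X → ℝ} {B D : ℝ}
    (hw : ∀ x, |w x| ≤ B) (hvw : ∀ x, |v x - w x| ≤ D) (x : X) :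
    kruzkovBellman f c v x ≤ kruzkovBellman f c w x + Real.exp (-δ) * D := by
  have hexp (u : U) : Real.exp (-c x u) ≤ Real.exp (-δ) :=
    Real.exp_le_exp.2 (neg_le_neg (hc x u))
  have hD : 0 ≤ D := (abs_nonneg _).trans (hvw x)
  have hB : 0 ≤ B := (abs_nonneg _).trans (hw x)
  have hbdd : BddAbove {r : ℝ | ∃ u : U, r = Real.exp (-c x u) * w (f x u)} := by
    refine ⟨Real.exp (-δ) * B, ?_⟩
    rintro _ ⟨u, rfl⟩
    exact (mul_le_mul_of_nonneg_left ((le_abs_self _).trans (hw _)) (Real.exp_nonneg _)).trans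
      (mul_le_mul_of_nonneg_right (hexp u) hB)
  refine csSup_le ⟨_, Classical.arbitrary U, rfl⟩ ?_
  rintro _ ⟨u, rfl⟩
  have hv : v (f x u) ≤ w (f x u) + D := by linarith [le_of_abs_le (hvw (f x u))]
  calc Real.exp (-c x u) * v (f x u)
      ≤ Real.exp (-c x u) * (w (f x u) + D) := mul_le_mul_of_nonneg_left hv (Real.exp_nonneg _)
    _ = Real.exp (-c x u) * w (f x u) + Real.exp (-c x u) * D := mul_add _ _ _
    _ ≤ kruzkovBellman f c w x + Real.exp (-δ) * D :=
      add_le_add (le_csSup hbdd ⟨u, rfl⟩) (mul_le_mul_of_nonneg_right (hexp u) hD)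

theorem abs_kruzkovBellman_sub_le (hc : ∀ x u, δ ≤ c x u) {v w : X → ℝ} {A B D : ℝ}
    (hv : ∀ x, |v x| ≤ A) (hw : ∀ x, |w x| ≤ B) (hvw : ∀ x, |v x - w x| ≤ D) (x : X) :
    |kruzkovBellman f c v x - kruzkovBellman f c w x| ≤ Real.exp (-δ) * D := by
  have h₁ := kruzkovBellman_le_add (f := f) hc hw hvw x
  have h₂ := kruzkovBellman_le_add (f := f) hc hv (fun y => abs_sub_comm (v y) (w y) ▸ hvw y) x
  exact abs_sub_le_iff.2 ⟨by linarith, by linarith⟩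

theorem abs_kruzkovBellman_iterate_sub_le (hc : ∀ x u, δ ≤ c x u) {w : X → ℝ} {B D : ℝ}
    (hw : ∀ x, |w x| ≤ B) (hfix : ∀ x, w x = kruzkovBellman f c w x) {seq : ℕ → X → ℝ}
    (hseq : ∀ m, seq (m + 1) = kruzkovBellman f c (seq m))
    (h0 : ∀ x, |seq 0 x - w x| ≤ D) (m : ℕ) (x : X) :
    |seq m x - w x| ≤ Real.exp (-(m : ℝ) * δ) * D := by
  induction m generalizing x with
  | zero => simpa using h0 x
  | succ m ih =>
    have hbound (y : X) : |seq m y| ≤ Real.exp (-(m : ℝ) * δ) * D + B := by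
      have h := abs_add_le (seq m y - w y) (w y)
      rw [sub_add_cancel] at h
      exact h.trans (add_le_add (ih y) (hw y))
    rw [hseq, hfix x]
    refine (abs_kruzkovBellman_sub_le hc hbound hw ih x).trans_eq ?_
    rw [← mul_assoc, ← Real.exp_add]
    push_cast
    ring_nf

theorem tendsto_exp_neg_natCast_mul (hδ : 0 < δ) (D : ℝ) :
    Filter.Tendsto (fun m : ℕ => Real.exp (-(m : ℝ) * δ) * D) Filter.atTop (nhds 0) := by
  have h : Filter.Tendsto (fun m : ℕ => (m : ℝ) * δ) Filter.atTop Filter.atTop :=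
    tendsto_natCast_atTop_atTop.atTop_mul_const hδ
  simpa using (Real.tendsto_exp_neg_atTop_nhds_zero.comp h).mul_const D

theorem kruzkovBellman_fixed_point_unique (hδ : 0 < δ) (hc : ∀ x u, δ ≤ c x u) {v w : X → ℝ}
    {A B : ℝ} (hv : ∀ x, |v x| ≤ A) (hvfix : ∀ x, v x = kruzkovBellman f c v x)
    (hw : ∀ x, |w x| ≤ B) (hwfix : ∀ x, w x = kruzkovBellman f c w x) : v = w := by
  funext x
  have h0 (y : X) : |v y - w y| ≤ A + B := (abs_sub _ _).trans (add_le_add (hv y) (hw y))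
  have h := ge_of_tendsto' (tendsto_exp_neg_natCast_mul hδ (A + B)) fun m =>
    abs_kruzkovBellman_iterate_sub_le hc hw hwfix (seq := fun _ => v)
      (fun _ => funext hvfix) h0 m x
  exact sub_eq_zero.1 (abs_nonpos_iff.1 h)

theorem kruzkovBellman_zero (x : X) : kruzkovBellman f c (fun _ => 0) x = 0 := by
  simp [kruzkovBellman]

end KruzkovBellman

/-- if `c(x,u) ≥ δ > 0` for all `x, u` and `c` is bounded above, then
the Kružkov–Bellman operator has a unique bounded fixed point `v̂`, and for every
bounded initial guess `v⁰` the iterates `v^{m+1} = S[v^m]` converge uniformly to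
`v̂`, with `sup_x |v^m(x) − v̂(x)| ≤ exp(−mδ)·sup_x |v⁰(x) − v̂(x)|`. -/
theorem kruzkovBellman_unique_fixed_point_and_iteration
    {nx : ℕ} {U : Type*} [Nonempty U]
    (f : (Fin nx → ℝ) → U → (Fin nx → ℝ)) (c : (Fin nx → ℝ) → U → ℝ)
    (δ : ℝ) (hδ : 0 < δ) (hc : ∀ x u, δ ≤ c x u)
    (Mc : ℝ) (hMc : ∀ x u, c x u ≤ Mc) :
    (∃! vhat : (Fin nx → ℝ) → ℝ,
      (∃ B, ∀ x, |vhat x| ≤ B) ∧ ∀ x, vhat x = kruzkovBellman f c vhat x) ∧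
    (∀ vhat : (Fin nx → ℝ) → ℝ,
      ((∃ B, ∀ x, |vhat x| ≤ B) ∧ ∀ x, vhat x = kruzkovBellman f c vhat x) →
      ∀ v0 : (Fin nx → ℝ) → ℝ, (∃ B0, ∀ x, |v0 x| ≤ B0) →
      ∀ seq : ℕ → (Fin nx → ℝ) → ℝ,
        seq 0 = v0 → (∀ m, seq (m + 1) = kruzkovBellman f c (seq m)) →
        TendstoUniformly seq vhat Filter.atTop ∧
        ∀ (m : ℕ) (x : Fin nx → ℝ),
          |seq m x - vhat x| ≤
            Real.exp (-(m : ℝ) * δ) * ⨆ y : Fin nx → ℝ, |v0 y - vhat y|) := by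
  refine ⟨⟨fun _ => 0, ⟨⟨0, by simp⟩, fun x => (kruzkovBellman_zero x).symm⟩, ?_⟩, ?_⟩
  · rintro v ⟨⟨B, hB⟩, hv⟩
    exact kruzkovBellman_fixed_point_unique hδ hc hB hv (B := 0) (by simp)
      fun x => (kruzkovBellman_zero x).symm
  · rintro vhat ⟨⟨B, hB⟩, hfix⟩ v0 ⟨B0, hB0⟩ seq rfl hseq
    have hbdd : BddAbove (Set.range fun y => |seq 0 y - vhat y|) := by
      refine ⟨B0 + B, ?_⟩
      rintro _ ⟨y, rfl⟩
      exact (abs_sub _ _).trans (add_le_add (hB0 y) (hB y))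
    have hrate := abs_kruzkovBellman_iterate_sub_le hc hB hfix hseq (le_ciSup hbdd)
    refine ⟨Metric.tendstoUniformly_iff.2 fun ε hε => ?_, hrate⟩
    filter_upwards [(tendsto_exp_neg_natCast_mul hδ _).eventually_lt_const hε] with m hm x
    rw [dist_comm, Real.dist_eq]
    exact (hrate m x).trans_lt hm
end

section
/- Let U be a nonempty set, f : ℝ^{n_x} × U → ℝ^{n_x}, c : ℝ^{n_x} × U → ℝ, 0 < β < 1, and let V : ℝ^{n_x} → ℝ be bounded. Suppose a control sequence (u_n)_{n∈ℕ} with u_n ∈ U and the trajectory x_{n+1} = f(x_n,u_n), x_0 = x₀, satisfy the greedy (Bellman-minimizing) condition V(x_n) = c(x_n,u_n) + β·V(f(x_n,u_n)) for every n ∈ ℕ. Then the series Σ_{n=0}^∞ β^n c(x_n,u_n) converges and equals V(x₀). In particular, if V is the value function, the forward recursion that at each step selects a minimizer of the Bellman equation produces an optimal trajectory. -/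
/-- Trajectory of the discrete dynamics `x_{n+1} = f(x_n, u_n)`, `x_0 = x₀`. -/
def traj {X U : Type*} (f : X → U → X) (x₀ : X) (u : ℕ → U) : ℕ → X
  | 0 => x₀
  | n + 1 => f (traj f x₀ u n) (u n)

/-- If `v` is bounded and `v n = a n + β * v (n + 1)` with `|β| < 1`, then the discounted series
of `a` sums to `v 0`. -/
theorem hasSum_discounted_of_bounded_recursion {β B : ℝ} (hβ : |β| < 1) {v a : ℕ → ℝ}
    (hv : ∀ n, |v n| ≤ B) (h : ∀ n, v n = a n + β * v (n + 1)) :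
    HasSum (fun n => β ^ n * a n) (v 0) := by
  have hs : Summable fun n => β ^ n * v n := by
    refine Summable.of_norm_bounded
      ((summable_geometric_of_lt_one (abs_nonneg β) hβ).mul_right B) fun n => ?_
    rw [Real.norm_eq_abs, abs_mul, abs_pow]
    exact mul_le_mul_of_nonneg_left (hv n) (by positivity)
  have hs' : Summable fun n => β ^ (n + 1) * v (n + 1) :=
    (summable_nat_add_iff (f := fun n => β ^ n * v n) 1).2 hs
  have hterm : (fun n => β ^ n * a n) = fun n => β ^ n * v n - β ^ (n + 1) * v (n + 1) := by
    funext n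
    rw [h n]
    ring
  have hzero : v 0 = ∑' n, β ^ n * v n - ∑' n, β ^ (n + 1) * v (n + 1) := by
    rw [hs.tsum_eq_zero_add]
    simp
  rw [hterm, hzero]
  exact hs.hasSum.sub hs'.hasSum

/-- if a bounded `V` and a control sequence satisfy the greedy
(Bellman-minimizing) identity `V(x_n) = c(x_n,u_n) + β·V(f(x_n,u_n))` along the
trajectory, then `Σ_{n=0}^∞ β^n c(x_n,u_n)` converges and equals `V(x₀)`. -/
theorem greedy_trajectory_cost_eq_value
    {nx : ℕ} {U : Type*} [Nonempty U]
    (f : (Fin nx → ℝ) → U → (Fin nx → ℝ)) (c : (Fin nx → ℝ) → U → ℝ)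
    (β : ℝ) (hβ0 : 0 < β) (hβ1 : β < 1)
    (V : (Fin nx → ℝ) → ℝ) (hVb : ∃ B, ∀ x, |V x| ≤ B)
    (x₀ : Fin nx → ℝ) (u : ℕ → U)
    (hgreedy : ∀ n : ℕ,
      V (traj f x₀ u n) =
        c (traj f x₀ u n) (u n) + β * V (f (traj f x₀ u n) (u n))) :
    Summable (fun n : ℕ => β ^ n * c (traj f x₀ u n) (u n)) ∧
    (∑' n : ℕ, β ^ n * c (traj f x₀ u n) (u n)) = V x₀ := by
  obtain ⟨B, hB⟩ := hVb
  have hsum : HasSum (fun n => β ^ n * c (traj f x₀ u n) (u n)) (V x₀) :=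
    hasSum_discounted_of_bounded_recursion (v := fun n => V (traj f x₀ u n))
      (abs_lt.2 ⟨by linarith, hβ1⟩) (fun n => hB _) hgreedy
  exact ⟨hsum.summable, hsum.tsum_eq⟩
end

section
/- Let U be a nonempty set, F : ℝ^{n_x} × U → ℝ^{n_x}, C : ℝ^{n_x} × U → ℝ with |C(x,u)| ≤ M for all x, u, and λ > 0. Let W : ℝ^{n_x} → ℝ be differentiable and bounded, and assume the subsolution inequality λ·W(x) ≤ DW(x)[F(x,u)] + C(x,u) holds for every x ∈ ℝ^{n_x} and u ∈ U, where DW(x) denotes the derivative (gradient pairing) of W at x. Let u : [0,∞) → U and let x : [0,∞) → ℝ^{n_x} be differentiable with x′(t) = F(x(t), u(t)) for all t ≥ 0, x(0) = x₀, and assume t ↦ C(x(t),u(t)) is continuous. Then the improper integral ∫₀^∞ exp(−λt)·C(x(t),u(t)) dt converges and W(x₀) ≤ ∫₀^∞ exp(−λt)·C(x(t),u(t)) dt. In particular W(x₀) is a lower bound for the discounted cost of every admissible trajectory starting at x₀. -/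
open MeasureTheory
open Filter Topology

/-- a bounded differentiable subsolution `W` of the continuous
HJB equation (`λ·W(x) ≤ DW(x)[F(x,u)] + C(x,u)` for all `x, u`, with `λ > 0` and
`|C| ≤ M`) bounds the discounted cost of every admissible trajectory from below:
the improper integral `∫₀^∞ exp(−λt)·C(x(t),u(t)) dt` converges and
`W(x₀) ≤ ∫₀^∞ exp(−λt)·C(x(t),u(t)) dt`. -/
theorem hjb_subsolution_lower_bound
    {nx : ℕ} {U : Type*} [Nonempty U]
    (F : (Fin nx → ℝ) → U → (Fin nx → ℝ)) (C : (Fin nx → ℝ) → U → ℝ)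
    (M : ℝ) (hC : ∀ x u, |C x u| ≤ M)
    (lam : ℝ) (hlam : 0 < lam)
    (W : (Fin nx → ℝ) → ℝ) (hWdiff : Differentiable ℝ W)
    (hWb : ∃ B, ∀ x, |W x| ≤ B)
    (hsub : ∀ (x : Fin nx → ℝ) (u : U),
      lam * W x ≤ fderiv ℝ W x (F x u) + C x u)
    (u : ℝ → U) (x : ℝ → (Fin nx → ℝ)) (x₀ : Fin nx → ℝ)
    (hx0 : x 0 = x₀)
    (hx : ∀ t : ℝ, 0 ≤ t → HasDerivAt x (F (x t) (u t)) t)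
    (hcont : ContinuousOn (fun t => C (x t) (u t)) (Set.Ici (0 : ℝ))) :
    IntegrableOn (fun t => Real.exp (-lam * t) * C (x t) (u t)) (Set.Ici (0 : ℝ)) ∧
    W x₀ ≤ ∫ t in Set.Ici (0 : ℝ), Real.exp (-lam * t) * C (x t) (u t) := by
  have hexp : Continuous fun t : ℝ => Real.exp (-lam * t) := by fun_prop
  have hφ : ContinuousOn (fun t => Real.exp (-lam * t) * C (x t) (u t)) (Set.Ici 0) :=
    hexp.continuousOn.mul hcont
  have hint : IntegrableOn (fun t => Real.exp (-lam * t) * C (x t) (u t)) (Set.Ici 0) := by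
    have hdom : IntegrableOn (fun t => Real.exp (-lam * t) * M) (Set.Ici 0) :=
      ((integrableOn_Ici_iff_integrableOn_Ioi).mpr (exp_neg_integrableOn_Ioi 0 hlam)).mul_const M
    refine hdom.mono' (hφ.aestronglyMeasurable measurableSet_Ici) (ae_of_all _ fun t => ?_)
    rw [Real.norm_eq_abs, abs_mul, Real.abs_exp]
    gcongr
    exact hC _ _
  refine ⟨hint, ?_⟩
  have hderiv : ∀ t, 0 ≤ t → HasDerivAt (fun t => -(Real.exp (-lam * t) * W (x t)))
      (Real.exp (-lam * t) * (lam * W (x t) - fderiv ℝ W (x t) (F (x t) (u t)))) t := by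
    intro t ht
    have hW := (hWdiff (x t)).hasFDerivAt.comp_hasDerivAt t (hx t ht)
    have hE := ((hasDerivAt_id t).const_mul (-lam)).exp
    refine (hE.mul hW).neg.congr_deriv ?_
    simp only [id, Function.comp_apply]
    ring
  have hfinite : ∀ T, 0 ≤ T → W x₀ - Real.exp (-lam * T) * W (x T) ≤
      ∫ t in (0 : ℝ)..T, Real.exp (-lam * t) * C (x t) (u t) := by
    intro T hT
    have key := intervalIntegral.sub_le_integral_of_hasDeriv_right_of_le hT
      (fun t ht => (hderiv t ht.1).continuousAt.continuousWithinAt)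
      (fun t ht => (hderiv t ht.1.le).hasDerivWithinAt)
      (hint.mono_set Set.Icc_subset_Ici_self)
      (fun t _ => mul_le_mul_of_nonneg_left (by linarith [hsub (x t) (u t)])
        (Real.exp_pos (-lam * t)).le)
    simp only [mul_zero, Real.exp_zero, one_mul, hx0] at key
    linarith
  have hdecay : Tendsto (fun T => Real.exp (-lam * T) * W (x T)) atTop (𝓝 0) := by
    obtain ⟨B, hB⟩ := hWb
    have hexp0 : Tendsto (fun T => Real.exp (-lam * T)) atTop (𝓝 0) :=
      Real.tendsto_exp_atBot.comp (tendsto_id.const_mul_atTop_of_neg (neg_lt_zero.mpr hlam))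
    exact hexp0.zero_mul_isBoundedUnder_le
      (isBoundedUnder_of ⟨B, fun T => by simpa using hB (x T)⟩)
  rw [integral_Ici_eq_integral_Ioi]
  have hleft : Tendsto (fun T => W x₀ - Real.exp (-lam * T) * W (x T)) atTop (𝓝 (W x₀)) := by
    simpa using tendsto_const_nhds.sub hdecay
  exact le_of_tendsto_of_tendsto hleft
    (intervalIntegral_tendsto_integral_Ioi 0 (hint.mono_set Set.Ioi_subset_Ici_self)
      tendsto_id)
    ((eventually_ge_atTop 0).mono hfinite)
end
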